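/- arXiv:1009.1585 — 2 statements merged into one kernel-verified Lean document; each statement's English description precedes it below -/
import Mathlib

section
/- Let x̄ ∉ Ω with T(x̄) < ∞ and let w̄ ∈ Π(x̄) be a generalized projection point of x̄ onto Ω. Then for every λ ∈ (0,1) one has T(λ w̄ + (1−λ) x̄) = (1−λ) T(x̄). -/
open Set Filter Topology Pointwise
open scoped ENNReal

variable {X : Type*}

/-- Minimal time function `T(x) = inf{t ≥ 0 : Ω ∩ (x + tF) ≠ ∅}`, with `inf ∅ = ∞`. -/
noncomputable def mtime [NormedAddCommGroup X] [NormedSpace ℝ X]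
    (Ω F : Set X) (x : X) : ℝ≥0∞ :=
  ⨅ (t : ℝ) (_ : 0 ≤ t ∧ ∃ q ∈ F, x + t • q ∈ Ω), ENNReal.ofReal t

/-- Minkowski gauge `ρ_F(u) = inf{t ≥ 0 : u ∈ tF}`, with `inf ∅ = ∞`. -/
noncomputable def mgauge [NormedAddCommGroup X] [NormedSpace ℝ X]
    (F : Set X) (u : X) : ℝ≥0∞ :=
  ⨅ (t : ℝ) (_ : 0 ≤ t ∧ ∃ q ∈ F, u = t • q), ENNReal.ofReal t

/-- Enlargement `Ω_r = {x : T(x) ≤ r}` of the target set. -/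
noncomputable def enl [NormedAddCommGroup X] [NormedSpace ℝ X]
    (Ω F : Set X) (r : ℝ) : Set X :=
  {x | mtime Ω F x ≤ ENNReal.ofReal r}

/-- Generalized (minimal time) projection `Π(x) = (x + T(x)·F) ∩ Ω`. -/
noncomputable def mproj [NormedAddCommGroup X] [NormedSpace ℝ X]
    (Ω F : Set X) (x : X) : Set X :=
  {w | w ∈ Ω ∧ ∃ q ∈ F, w = x + (mtime Ω F x).toReal • q}

/-- Support function `σ_F(x*) = sup_{q ∈ F} ⟨x*, q⟩`. -/
noncomputable def suppFn [NormedAddCommGroup X] [NormedSpace ℝ X]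
    (F : Set X) (p : X →L[ℝ] ℝ) : ℝ :=
  sSup ((fun q => p q) '' F)

/-- Dynamics bound `‖F‖ = sup{‖q‖ : q ∈ F}`. -/
noncomputable def dynBound [NormedAddCommGroup X] (F : Set X) : ℝ :=
  sSup ((fun q => ‖q‖) '' F)

/-- Fréchet `ε`-subdifferential of `φ` at `xb`:
`liminf_{x→xb} (φ(x) − φ(xb) − ⟨x*, x−xb⟩)/‖x−xb‖ ≥ −ε`. -/
def fsub [NormedAddCommGroup X] [NormedSpace ℝ X]
    (φ : X → ℝ≥0∞) (ε : ℝ) (xb : X) : Set (X →L[ℝ] ℝ) :=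
  {p | ∀ γ > (0:ℝ), ∃ δ > (0:ℝ), ∀ x, ‖x - xb‖ < δ →
    ENNReal.ofReal ((φ xb).toReal + p (x - xb) - (ε + γ) * ‖x - xb‖) ≤ φ x}

/-- Set of `ε`-normals to `Θ` at `xb ∈ Θ`. -/
def enormal [NormedAddCommGroup X] [NormedSpace ℝ X]
    (Θ : Set X) (ε : ℝ) (xb : X) : Set (X →L[ℝ] ℝ) :=
  {p | ∀ γ > (0:ℝ), ∃ δ > (0:ℝ), ∀ x ∈ Θ, ‖x - xb‖ < δ →
    p (x - xb) ≤ (ε + γ) * ‖x - xb‖}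

/-- Basic (limiting/Mordukhovich) normal cone. -/
def bnormal [NormedAddCommGroup X] [NormedSpace ℝ X]
    (Θ : Set X) (xb : X) : Set (X →L[ℝ] ℝ) :=
  {p | ∃ (ε : ℕ → ℝ) (x : ℕ → X) (ps : ℕ → X →L[ℝ] ℝ),
    (∀ k, 0 ≤ ε k) ∧ Tendsto ε atTop (𝓝 0) ∧
    (∀ k, x k ∈ Θ) ∧ Tendsto x atTop (𝓝 xb) ∧
    (∀ k, ps k ∈ enormal Θ (ε k) (x k)) ∧
    (∀ v, Tendsto (fun k => ps k v) atTop (𝓝 (p v)))}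

/-- Basic (limiting/Mordukhovich) subdifferential. -/
def bsub [NormedAddCommGroup X] [NormedSpace ℝ X]
    (φ : X → ℝ≥0∞) (xb : X) : Set (X →L[ℝ] ℝ) :=
  {p | ∃ (ε : ℕ → ℝ) (x : ℕ → X) (ps : ℕ → X →L[ℝ] ℝ),
    (∀ k, 0 ≤ ε k) ∧ Tendsto ε atTop (𝓝 0) ∧
    Tendsto x atTop (𝓝 xb) ∧
    Tendsto (fun k => φ (x k)) atTop (𝓝 (φ xb)) ∧
    (∀ k, ps k ∈ fsub φ (ε k) (x k)) ∧
    (∀ v, Tendsto (fun k => ps k v) atTop (𝓝 (p v)))}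

/-- Singular (Mordukhovich) subdifferential. -/
def ssub [NormedAddCommGroup X] [NormedSpace ℝ X]
    (φ : X → ℝ≥0∞) (xb : X) : Set (X →L[ℝ] ℝ) :=
  {p | ∃ (ε lam : ℕ → ℝ) (x : ℕ → X) (ps : ℕ → X →L[ℝ] ℝ),
    (∀ k, 0 ≤ ε k) ∧ Tendsto ε atTop (𝓝 0) ∧
    (∀ k, 0 < lam k) ∧ Tendsto lam atTop (𝓝 0) ∧
    Tendsto x atTop (𝓝 xb) ∧
    Tendsto (fun k => φ (x k)) atTop (𝓝 (φ xb)) ∧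
    (∀ k, ps k ∈ fsub φ (ε k) (x k)) ∧
    (∀ v, Tendsto (fun k => lam k * ps k v) atTop (𝓝 (p v)))}

/-- Subdifferential of convex analysis (for `ℝ≥0∞`-valued convex functions,
finite at the reference point). -/
def csub [NormedAddCommGroup X] [NormedSpace ℝ X]
    (φ : X → ℝ≥0∞) (xb : X) : Set (X →L[ℝ] ℝ) :=
  {p | ∀ x, ENNReal.ofReal (p (x - xb) + (φ xb).toReal) ≤ φ x}

/-- Normal cone of convex analysis. -/
def cnormal [NormedAddCommGroup X] [NormedSpace ℝ X]
    (Θ : Set X) (xb : X) : Set (X →L[ℝ] ℝ) :=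
  {p | ∀ x ∈ Θ, p (x - xb) ≤ 0}

theorem mtime_le_ofReal [NormedAddCommGroup X] [NormedSpace ℝ X] {Ω F : Set X} {x q : X} {t : ℝ}
    (ht : 0 ≤ t) (hq : q ∈ F) (h : x + t • q ∈ Ω) : mtime Ω F x ≤ ENNReal.ofReal t :=
  iInf₂_le t ⟨ht, q, hq, h⟩

/-- Moving for time `s` along an admissible velocity decreases the minimal time by at most `s`. -/
theorem mtime_le_ofReal_add_mtime [NormedAddCommGroup X] [NormedSpace ℝ X] {Ω F : Set X}
    (hF : Convex ℝ F) (x : X) {q : X} (hq : q ∈ F) {s : ℝ} (hs : 0 ≤ s) :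
    mtime Ω F x ≤ ENNReal.ofReal s + mtime Ω F (x + s • q) := by
  rw [mtime.eq_def Ω F (x + s • q)]
  simp only [ENNReal.add_iInf]
  refine le_iInf₂ fun t ⟨ht, p, hp, hmem⟩ => ?_
  obtain ⟨r, hr, hreq⟩ : s • q + t • p ∈ (s + t) • F := by
    rw [hF.add_smul hs ht]
    exact add_mem_add (smul_mem_smul_set hq) (smul_mem_smul_set hp)
  rw [← ENNReal.ofReal_add hs ht]
  refine mtime_le_ofReal (add_nonneg hs ht) hr ?_
  have hreq' : (s + t) • r = s • q + t • p := hreq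
  rwa [hreq', ← add_assoc]

/-- Proposition 3.4: minimal time linearity with respect to projections:
if `x̄ ∉ Ω`, `T(x̄) < ∞`, and `w̄ ∈ Π(x̄)`, then
`T(λw̄ + (1−λ)x̄) = (1−λ)T(x̄)` for all `λ ∈ (0,1)`. -/
theorem mtime_linear_on_projection [NormedAddCommGroup X] [NormedSpace ℝ X]
    [CompleteSpace X]
    (Ω F : Set X) (hΩne : Ω.Nonempty) (hΩcl : IsClosed Ω)
    (hFne : F.Nonempty) (hFcl : IsClosed F) (hFbd : Bornology.IsBounded F)
    (hFcv : Convex ℝ F)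
    (xb : X) (hxb : xb ∉ Ω) (hfin : mtime Ω F xb < ⊤)
    (wb : X) (hwb : wb ∈ mproj Ω F xb)
    (l : ℝ) (hl0 : 0 < l) (hl1 : l < 1) :
    mtime Ω F (l • wb + (1 - l) • xb) = ENNReal.ofReal (1 - l) * mtime Ω F xb := by
  obtain ⟨hwΩ, q, hq, hw⟩ := hwb
  set T := (mtime Ω F xb).toReal
  have hT0 : 0 ≤ T := ENNReal.toReal_nonneg
  have hmT : mtime Ω F xb = ENNReal.ofReal T := (ENNReal.ofReal_toReal hfin.ne).symm
  have hl : 0 ≤ 1 - l := by linarith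
  have hy : l • wb + (1 - l) • xb = xb + (l * T) • q := by
    rw [hw]; module
  rw [hy]
  apply le_antisymm
  · rw [hmT, ← ENNReal.ofReal_mul hl]
    refine mtime_le_ofReal (mul_nonneg hl hT0) hq ?_
    have hend : xb + (l * T) • q + ((1 - l) * T) • q = wb := by
      rw [hw]; module
    rwa [hend]
  · have hlT : 0 ≤ l * T := mul_nonneg hl0.le hT0
    have hle := mtime_le_ofReal_add_mtime (Ω := Ω) hFcv xb hq hlT
    have hsplit : mtime Ω F xb
        = ENNReal.ofReal (l * T) + ENNReal.ofReal (1 - l) * mtime Ω F xb := by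
      rw [hmT, ← ENNReal.ofReal_mul hl, ← ENNReal.ofReal_add hlT (mul_nonneg hl hT0)]
      congr 1
      ring
    rw [hsplit] at hle
    exact (ENNReal.add_le_add_iff_left ENNReal.ofReal_ne_top).1 hle
end

section
/- Let x̄ ∉ Ω with r := T(x̄) < ∞. Then for all ε ≥ 0 one has the upper estimate ∂̂_ε T(x̄) ⊆ N̂_ε(x̄; Ω_r) ∩ S*_ε. Conversely, if T is calm at x̄ with constant κ (i.e., |T(x) − T(x̄)| ≤ κ‖x − x̄‖ for all x near x̄), then every x* ∈ N̂_ε(x̄; Ω_r) ∩ S*_ε, ε ≥ 0, satisfies x* ∈ ∂̂_{ℓε} T(x̄) with ℓ = ℓ(x*) := 1 + 2‖x*‖·‖F‖ + 2κ‖F‖. -/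
open Set Filter Topology Pointwise
open scoped ENNReal

variable {X : Type*}

section MinimalTime

variable [NormedAddCommGroup X]

theorem norm_le_dynBound {F : Set X} (hF : Bornology.IsBounded F) {q : X} (hq : q ∈ F) :
    ‖q‖ ≤ dynBound F := by
  obtain ⟨C, hC⟩ := hF.exists_norm_le
  exact le_csSup ⟨C, by rintro _ ⟨y, hy, rfl⟩; exact hC y hy⟩ ⟨q, hq, rfl⟩

theorem dynBound_nonneg (F : Set X) : 0 ≤ dynBound F :=
  Real.sSup_nonneg (by rintro _ ⟨y, -, rfl⟩; exact norm_nonneg y)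

variable [NormedSpace ℝ X] {Ω F : Set X} {x q : X} {s t : ℝ}

theorem apply_le_suppFn (hF : Bornology.IsBounded F) (p : X →L[ℝ] ℝ) (hq : q ∈ F) :
    p q ≤ suppFn F p := by
  obtain ⟨C, hC⟩ := hF.exists_norm_le
  refine le_csSup ⟨‖p‖ * C, ?_⟩ ⟨q, hq, rfl⟩
  rintro _ ⟨y, hy, rfl⟩
  calc p y ≤ ‖p y‖ := Real.le_norm_self _
    _ ≤ ‖p‖ * ‖y‖ := p.le_opNorm y
    _ ≤ ‖p‖ * C := by gcongr; exact hC y hy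

theorem mtime_le (ht : 0 ≤ t) (hq : q ∈ F) (h : x + t • q ∈ Ω) :
    mtime Ω F x ≤ ENNReal.ofReal t :=
  iInf₂_le t ⟨ht, q, hq, h⟩

/-- Every `s > T(x)` is bounded below by an admissible time, itself at least `T(x)`. -/
theorem exists_admissible_time_lt (hx : mtime Ω F x ≠ ⊤) (hs : (mtime Ω F x).toReal < s) :
    ∃ t, 0 ≤ t ∧ (mtime Ω F x).toReal ≤ t ∧ t < s ∧ ∃ q ∈ F, x + t • q ∈ Ω := by
  have hlt : mtime Ω F x < ENNReal.ofReal s := (ENNReal.lt_ofReal_iff_toReal_lt hx).2 hs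
  unfold mtime at hlt
  simp only [iInf_lt_iff] at hlt
  obtain ⟨t, ⟨ht, q, hq, h⟩, hts⟩ := hlt
  refine ⟨t, ht, ENNReal.toReal_le_of_le_ofReal ht (mtime_le ht hq h), ?_, q, hq, h⟩
  exact (ENNReal.ofReal_lt_ofReal_iff_of_nonneg ht).1 hts

theorem mtime_add_smul_le (hq : q ∈ F) (hts : t ≤ s) (h : x + s • q ∈ Ω) :
    mtime Ω F (x + t • q) ≤ ENNReal.ofReal (s - t) := by
  refine mtime_le (sub_nonneg.2 hts) hq ?_
  rwa [add_assoc, ← add_smul, add_sub_cancel]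

/-- Moving backwards along the dynamics for time `t` costs at most `t`. -/
theorem mtime_sub_smul_le (hF : Convex ℝ F) (hx : mtime Ω F x ≠ ⊤) (ht : 0 ≤ t) (hq : q ∈ F) :
    mtime Ω F (x - t • q) ≤ ENNReal.ofReal ((mtime Ω F x).toReal + t) := by
  refine ENNReal.le_of_forall_pos_le_add fun η hη _ => ?_
  obtain ⟨s, hs, -, hsη, q', hq', h⟩ := exists_admissible_time_lt hx
    (lt_add_of_pos_right _ (NNReal.coe_pos.2 hη))
  obtain ⟨y, hy, hyq⟩ : ∃ y ∈ F, t • q + s • q' = (t + s) • y := by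
    have := hF.add_smul ht hs ▸ Set.add_mem_add (Set.smul_mem_smul_set (a := t) hq)
      (Set.smul_mem_smul_set (a := s) hq')
    obtain ⟨y, hy, hyq⟩ := this
    exact ⟨y, hy, hyq.symm⟩
  have hle : mtime Ω F (x - t • q) ≤ ENNReal.ofReal (t + s) := by
    refine mtime_le (add_nonneg ht hs) hy ?_
    rw [← hyq]
    convert h using 1
    abel
  rw [← ENNReal.ofReal_coe_nnreal, ← ENNReal.ofReal_add (by positivity) (by positivity)]
  exact hle.trans (ENNReal.ofReal_le_ofReal (by linarith))

theorem mtime_toReal_pos (hΩ : IsClosed Ω) (hF : Bornology.IsBounded F)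
    (hx : x ∉ Ω) (hfin : mtime Ω F x ≠ ⊤) : 0 < (mtime Ω F x).toReal := by
  obtain ⟨δ, hδ, hball⟩ := Metric.isOpen_iff.1 hΩ.isOpen_compl x hx
  have hM := dynBound_nonneg F
  by_contra! hle
  obtain ⟨t, ht, -, htδ, q, hq, h⟩ := exists_admissible_time_lt
    (s := δ / (dynBound F + 1)) hfin (hle.trans_lt (by positivity))
  refine hball ?_ h
  rw [mem_ball_iff_norm, add_sub_cancel_left, norm_smul, Real.norm_of_nonneg ht]
  rw [lt_div_iff₀ (by positivity)] at htδ
  nlinarith [norm_le_dynBound hF hq]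

theorem fsub_mtime_subset_enormal (ε : ℝ) :
    fsub (mtime Ω F) ε x ⊆ enormal (enl Ω F (mtime Ω F x).toReal) ε x := by
  intro p hp γ hγ
  obtain ⟨δ, hδ, h⟩ := hp γ hγ
  refine ⟨δ, hδ, fun y hy hyx => ?_⟩
  have := (ENNReal.ofReal_le_ofReal_iff ENNReal.toReal_nonneg).1 ((h y hyx).trans hy)
  linarith

theorem suppFn_neg_le_of_mem_fsub_mtime (hne : F.Nonempty) (hbd : Bornology.IsBounded F)
    (hcv : Convex ℝ F) (hfin : mtime Ω F x ≠ ⊤) {ε : ℝ} (hε : 0 ≤ ε) {p : X →L[ℝ] ℝ}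
    (hp : p ∈ fsub (mtime Ω F) ε x) : suppFn F (-p) ≤ 1 + ε * dynBound F := by
  have hM := dynBound_nonneg F
  refine csSup_le (hne.image _) ?_
  rintro _ ⟨q, hq, rfl⟩
  have hqM := norm_le_dynBound hbd hq
  refine le_of_forall_pos_le_add fun η hη => ?_
  obtain ⟨δ, hδ, h⟩ := hp (η / (dynBound F + 1)) (by positivity)
  set γ := η / (dynBound F + 1) with hγ
  have hγη : γ * (dynBound F + 1) = η := by rw [hγ]; field_simp
  have hγ0 : 0 < γ := by positivity
  set t := δ / (dynBound F + 1) with ht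
  have ht0 : 0 < t := by positivity
  have htδ : t * (dynBound F + 1) = δ := by rw [ht]; field_simp
  have hnorm : ‖x - t • q - x‖ = t * ‖q‖ := by
    rw [sub_sub_cancel_left, norm_neg, norm_smul, Real.norm_of_nonneg ht0.le]
  have key := (ENNReal.ofReal_le_ofReal_iff (by positivity)).1
    ((h (x - t • q) (by rw [hnorm]; nlinarith)).trans (mtime_sub_smul_le hcv hfin ht0.le hq))
  rw [hnorm, sub_sub_cancel_left, map_neg, map_smul, smul_eq_mul] at key
  have hdiv : t * (-p q) ≤ t * (1 + (ε + γ) * ‖q‖) := by linarith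
  have := le_of_mul_le_mul_left hdiv ht0
  have h2 : (ε + γ) * ‖q‖ ≤ (ε + γ) * dynBound F := by gcongr
  change -p q ≤ _
  linarith

theorem le_suppFn_neg_of_mem_fsub_mtime (hΩ : IsClosed Ω) (hbd : Bornology.IsBounded F)
    (hx : x ∉ Ω) (hfin : mtime Ω F x ≠ ⊤) {ε : ℝ} (hε : 0 ≤ ε) {p : X →L[ℝ] ℝ}
    (hp : p ∈ fsub (mtime Ω F) ε x) : 1 - ε * dynBound F ≤ suppFn F (-p) := by
  have hM := dynBound_nonneg F
  have hr := mtime_toReal_pos hΩ hbd hx hfin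
  refine le_of_forall_pos_le_add fun η hη => ?_
  obtain ⟨δ, hδ, h⟩ := hp (η / (dynBound F + 1)) (by positivity)
  set γ := η / (dynBound F + 1) with hγ
  have hγη : γ * (dynBound F + 1) = η := by rw [hγ]; field_simp
  have hγ0 : 0 < γ := by positivity
  obtain ⟨t, ht0, htr, htδ⟩ : ∃ t > 0, t ≤ (mtime Ω F x).toReal ∧ t * (dynBound F + 1) ≤ δ :=
    ⟨min (mtime Ω F x).toReal (δ / (dynBound F + 1)), lt_min hr (by positivity), min_le_left _ _,
      (le_div_iff₀ (by positivity)).1 (min_le_right _ _)⟩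
  obtain ⟨s, -, hrs, hs, q, hq, hmem⟩ := exists_admissible_time_lt hfin
    (lt_add_of_pos_right (mtime Ω F x).toReal (mul_pos hγ0 ht0))
  have hqM := norm_le_dynBound hbd hq
  have hnorm : ‖x + t • q - x‖ = t * ‖q‖ := by
    rw [add_sub_cancel_left, norm_smul, Real.norm_of_nonneg ht0.le]
  have key := (ENNReal.ofReal_le_ofReal_iff (by linarith)).1
    ((h (x + t • q) (by rw [hnorm]; nlinarith)).trans
      (mtime_add_smul_le hq (htr.trans hrs) hmem))
  rw [hnorm, add_sub_cancel_left, map_smul, smul_eq_mul] at key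
  have hdiv : t * (1 - γ - (ε + γ) * ‖q‖) ≤ t * (-p q) := by linarith
  have := le_of_mul_le_mul_left hdiv ht0
  have h2 : (ε + γ) * ‖q‖ ≤ (ε + γ) * dynBound F := by gcongr
  have h3 : -p q ≤ suppFn F (-p) := apply_le_suppFn hbd (-p) hq
  linarith

/-- Calmness turns an `ε`-normal to the enlargement lying in `S*_ε` into a subgradient of `T`;
the resulting constant does not involve `‖p‖`. -/
theorem mem_fsub_mtime_of_mem_enormal (hne : F.Nonempty) (hbd : Bornology.IsBounded F)
    (hcv : Convex ℝ F) {κ : ℝ} (hκ : 0 ≤ κ)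
    (hcalm : ∃ δ > (0 : ℝ), ∀ y : X, ‖y - x‖ < δ → mtime Ω F y ≠ ⊤ ∧
      |(mtime Ω F y).toReal - (mtime Ω F x).toReal| ≤ κ * ‖y - x‖)
    {ε : ℝ} (hε : 0 ≤ ε) {p : X →L[ℝ] ℝ}
    (hp : p ∈ enormal (enl Ω F (mtime Ω F x).toReal) ε x)
    (hlow : 1 - ε * dynBound F ≤ suppFn F (-p)) (hup : suppFn F (-p) ≤ 1 + ε * dynBound F) :
    p ∈ fsub (mtime Ω F) ((1 + 2 * κ * dynBound F) * ε) x := by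
  intro γ hγ
  obtain ⟨δ₁, hδ₁, hcalm⟩ := hcalm
  have hM := dynBound_nonneg F
  set M := dynBound F with hMdef
  set r := (mtime Ω F x).toReal with hr
  set C := 2 + 2 * ε * M + κ * M + M + κ with hC
  have hC0 : 0 < C := by positivity
  obtain ⟨β, hβ0, hβ1, hβC⟩ : ∃ β > 0, β ≤ 1 ∧ β * C ≤ γ :=
    ⟨min 1 (γ / C), lt_min one_pos (by positivity), min_le_left _ _,
      (le_div_iff₀ hC0).1 (min_le_right _ _)⟩
  obtain ⟨δ₀, hδ₀, hnormal⟩ := hp β hβ0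
  set K := 1 + (κ + 1) * M with hK
  have hK0 : 0 < K := by positivity
  refine ⟨min δ₁ (δ₀ / K), lt_min hδ₁ (by positivity), fun y hy => ?_⟩
  obtain ⟨hyfin, hyabs⟩ := hcalm y (hy.trans_le (min_le_left _ _))
  have hyδ : ‖y - x‖ * K < δ₀ := (lt_div_iff₀ hK0).1 (hy.trans_le (min_le_right _ _))
  set n := ‖y - x‖ with hn
  have hn0 : 0 ≤ n := norm_nonneg _
  obtain ⟨hlo, hhi⟩ := abs_le.1 hyabs
  refine ENNReal.ofReal_le_of_le_toReal ?_
  set τ := (mtime Ω F y).toReal with hτ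
  have hβn : β * C * n ≤ γ * n := by gcongr
  -- Normality tested at the endpoint of a trajectory through `y` of bounded length.
  have step : ∀ a : ℝ, |a| ≤ (κ + β) * n → ∀ q ∈ F, y + a • q ∈ enl Ω F r →
      p (y - x) + a * p q ≤ (ε + β) * (1 + (κ + β) * M) * n := by
    intro a ha q hq hmem
    have hq' := norm_le_dynBound hbd hq
    have heq : y + a • q - x = (y - x) + a • q := by abel
    have hle : ‖y + a • q - x‖ ≤ (1 + (κ + β) * M) * n := by
      calc ‖y + a • q - x‖ ≤ ‖y - x‖ + ‖a • q‖ := by rw [heq]; exact norm_add_le _ _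
        _ = n + |a| * ‖q‖ := by rw [norm_smul, Real.norm_eq_abs]
        _ ≤ n + (κ + β) * n * M := by gcongr
        _ = _ := by ring
    have hlt : ‖y + a • q - x‖ < δ₀ := by
      refine hle.trans_lt (lt_of_le_of_lt ?_ hyδ)
      rw [mul_comm n, hK]
      gcongr
    have h := hnormal _ hmem hlt
    rw [heq, map_add, map_smul, smul_eq_mul, ← heq] at h
    refine h.trans ?_
    rw [mul_assoc]
    gcongr
  rcases le_or_gt τ r with hτr | hτr
  · obtain ⟨_, ⟨q, hq, rfl⟩, hq'⟩ := exists_lt_of_lt_csSup (hne.image fun q => (-p) q)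
      (show 1 - ε * M - β < suppFn F (-p) by linarith)
    change 1 - ε * M - β < -p q at hq'
    have hmem : y + (-(r - τ)) • q ∈ enl Ω F r := by
      have := mtime_sub_smul_le hcv hyfin (sub_nonneg.2 hτr) hq
      rwa [← hτ, add_sub_cancel, sub_eq_add_neg, ← neg_smul] at this
    have h := step _ (by rw [abs_neg, abs_of_nonneg (by linarith)]; nlinarith) q hq hmem
    have h1 : (r - τ) * (1 - ε * M - β) ≤ (r - τ) * (-p q) :=
      mul_le_mul_of_nonneg_left hq'.le (by linarith)
    have h2 : (r - τ) * (ε * M + β) ≤ κ * n * (ε * M + β) :=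
      mul_le_mul_of_nonneg_right (by linarith) (by positivity)
    have h3 : β * β * M * n ≤ β * 1 * M * n := by gcongr
    have h4 : 0 ≤ β * n := by positivity
    have h5 : 0 ≤ β * n * (ε * M) := by positivity
    simp only [hC] at hβn
    linarith
  · have hnpos : 0 < n := by
      refine hn0.lt_of_ne fun h0 => ?_
      rw [← h0] at hhi
      linarith
    obtain ⟨s, -, hτs, hs, q, hq, hmem⟩ := exists_admissible_time_lt hyfin
      (lt_add_of_pos_right τ (mul_pos hβ0 hnpos))
    have hmem' : y + (s - r) • q ∈ enl Ω F r := by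
      have := mtime_add_smul_le (t := s - r) hq (by linarith [ENNReal.toReal_nonneg.trans hr.ge])
        hmem
      rwa [sub_sub_cancel] at this
    have h := step _ (by rw [abs_of_nonneg (by linarith)]; linarith) q hq hmem'
    have hq' : -p q ≤ 1 + ε * M := (apply_le_suppFn hbd (-p) hq).trans hup
    have h1 : (s - r) * (-p q) ≤ (s - r) * (1 + ε * M) :=
      mul_le_mul_of_nonneg_left hq' (by linarith)
    have h2 : (s - r) * (ε * M) ≤ (κ + β) * n * (ε * M) :=
      mul_le_mul_of_nonneg_right (by linarith) (by positivity)
    have h3 : β * β * M * n ≤ β * 1 * M * n := by gcongr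
    have h4 : 0 ≤ β * n * κ := by positivity
    simp only [hC] at hβn
    linarith

end MinimalTime

/-- Theorem 4.6: `ε`-subgradients of minimal time functions at out-of-set
points via `ε`-normals to target enlargements: the upper estimate
`∂̂_ε T(x̄) ⊆ N̂_ε(x̄; Ω_r) ∩ S*_ε` holds for all `ε ≥ 0`; conversely, if `T` is
calm at `x̄` with constant `κ`, then every `x* ∈ N̂_ε(x̄; Ω_r) ∩ S*_ε` belongs
to `∂̂_{ℓε} T(x̄)` with `ℓ = 1 + 2‖x*‖‖F‖ + 2κ‖F‖`. -/
theorem fsub_mtime_enlargement [NormedAddCommGroup X] [NormedSpace ℝ X]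
    [CompleteSpace X]
    (Ω F : Set X) (hΩne : Ω.Nonempty) (hΩcl : IsClosed Ω)
    (hFne : F.Nonempty) (hFcl : IsClosed F) (hFbd : Bornology.IsBounded F)
    (hFcv : Convex ℝ F)
    (xb : X) (hxb : xb ∉ Ω) (hfin : mtime Ω F xb < ⊤) :
    (∀ ε : ℝ, 0 ≤ ε →
      fsub (mtime Ω F) ε xb ⊆
        enormal (enl Ω F (mtime Ω F xb).toReal) ε xb ∩
          {p | 1 - ε * dynBound F ≤ suppFn F (-p) ∧
            suppFn F (-p) ≤ 1 + ε * dynBound F}) ∧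
    (∀ κ : ℝ,
      (∃ δ > (0:ℝ), ∀ x : X, ‖x - xb‖ < δ → mtime Ω F x ≠ ⊤ ∧
        |(mtime Ω F x).toReal - (mtime Ω F xb).toReal| ≤ κ * ‖x - xb‖) →
      ∀ ε : ℝ, 0 ≤ ε →
        ∀ p ∈ enormal (enl Ω F (mtime Ω F xb).toReal) ε xb ∩
          {p | 1 - ε * dynBound F ≤ suppFn F (-p) ∧
            suppFn F (-p) ≤ 1 + ε * dynBound F},
          p ∈ fsub (mtime Ω F)
            ((1 + 2 * ‖p‖ * dynBound F + 2 * κ * dynBound F) * ε) xb) := by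
  refine ⟨fun ε hε p hp => ⟨fsub_mtime_subset_enormal ε hp,
    le_suppFn_neg_of_mem_fsub_mtime hΩcl hFbd hxb hfin.ne hε hp,
    suppFn_neg_le_of_mem_fsub_mtime hFne hFbd hFcv hfin.ne hε hp⟩, ?_⟩
  rintro κ hcalm ε hε p ⟨hp, hlow, hup⟩
  have hκ : 0 ≤ κ := by
    obtain ⟨δ, hδ, h⟩ := hcalm
    obtain ⟨ω, hω⟩ := hΩne
    have : Nontrivial X := ⟨⟨ω, xb, fun h => hxb (h ▸ hω)⟩⟩
    obtain ⟨v, hv⟩ := exists_norm_eq X (half_pos hδ).le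
    have hle := (abs_nonneg _).trans (h (xb + v) (by rw [add_sub_cancel_left, hv]; linarith)).2
    rw [add_sub_cancel_left, hv] at hle
    exact nonneg_of_mul_nonneg_left hle (half_pos hδ)
  intro γ hγ
  obtain ⟨δ, hδ, h⟩ := mem_fsub_mtime_of_mem_enormal hFne hFbd hFcv hκ hcalm hε hp hlow hup γ hγ
  refine ⟨δ, hδ, fun y hy => (ENNReal.ofReal_le_ofReal ?_).trans (h y hy)⟩
  have hM := dynBound_nonneg F
  gcongr
  linarith [show 0 ≤ ‖p‖ * dynBound F by positivity]
end
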